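/- Let ε > 0, λ ∈ ℝ, and let f : ℝ → ℝ be twice differentiable and satisfy −ε²·f''(x) + (1/4)·f(x) = ελ·f(x) for all x ∈ ℝ. Define φ(x) = −ε·f'(x) + (1/2)·tanh(x/(2ε))·f(x). Then φ is twice differentiable and satisfies −ε²·φ''(x) − (1/4)·φ(x) + (1/2)·tanh(x/(2ε))²·φ(x) = ελ·φ(x) for all x ∈ ℝ. In other words, applying (a^ε)* = −ε∂x + (1/2)tanh(x/(2ε)) turns an eigenfunction of a^ε(a^ε)* = −ε²∂x² + 1/4 into an eigenfunction of P^ε = (a^ε)*a^ε = −ε²∂x² − 1/4 + (1/2)tanh²(x/(2ε)) for the same eigenvalue ελ. -/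

import Mathlib

open Real

theorem hasDerivAt_tanh (x : ℝ) : HasDerivAt Real.tanh (1 - Real.tanh x ^ 2) x := by
  have hc : Real.cosh x ≠ 0 := (Real.cosh_pos x).ne'
  have h := (Real.hasDerivAt_sinh x).div (Real.hasDerivAt_cosh x) hc
  have htanh : Real.tanh = Real.sinh / Real.cosh := funext Real.tanh_eq_sinh_div_cosh
  rw [htanh]
  refine h.congr_deriv ?_
  simp only [Pi.div_apply]
  field_simp

theorem hasDerivAt_tanh_div (c x : ℝ) :
    HasDerivAt (fun y => Real.tanh (y / c)) ((1 - Real.tanh (x / c) ^ 2) / c) x :=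
  (HasDerivAt.comp (h₂ := Real.tanh) x (hasDerivAt_tanh (x / c))
    ((hasDerivAt_id x).div_const c)).congr_deriv (mul_one_div _ _)

theorem stmt_8 (ε : ℝ) (hε : 0 < ε) (lam : ℝ) (f : ℝ → ℝ)
    (hf : Differentiable ℝ f) (hf' : Differentiable ℝ (deriv f))
    (heq : ∀ x : ℝ, -(ε ^ 2) * deriv (deriv f) x + (1 / 4) * f x = ε * lam * f x) :
    (Differentiable ℝ (fun x => -ε * deriv f x + (1 / 2) * Real.tanh (x / (2 * ε)) * f x) ∧
     Differentiable ℝ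
       (deriv (fun x => -ε * deriv f x + (1 / 2) * Real.tanh (x / (2 * ε)) * f x))) ∧
    ∀ x : ℝ,
      -(ε ^ 2) *
          deriv (deriv (fun y => -ε * deriv f y + (1 / 2) * Real.tanh (y / (2 * ε)) * f y)) x
        - (1 / 4) * (-ε * deriv f x + (1 / 2) * Real.tanh (x / (2 * ε)) * f x)
        + (1 / 2) * Real.tanh (x / (2 * ε)) ^ 2 *
            (-ε * deriv f x + (1 / 2) * Real.tanh (x / (2 * ε)) * f x) =
      ε * lam * (-ε * deriv f x + (1 / 2) * Real.tanh (x / (2 * ε)) * f x) := by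
  obtain ⟨t, ht_def⟩ : ∃ t : ℝ → ℝ, ∀ x, t x = Real.tanh (x / (2 * ε)) := ⟨_, fun _ => rfl⟩
  have ht (x : ℝ) : HasDerivAt t ((1 - t x ^ 2) / (2 * ε)) x := by
    rw [funext ht_def]
    exact hasDerivAt_tanh_div (2 * ε) x
  simp only [← ht_def]
  obtain ⟨c, hc⟩ : ∃ c : ℝ, ε ^ 2 * c = 1 / 4 - ε * lam :=
    ⟨(1 / 4 - ε * lam) / ε ^ 2, by field_simp⟩
  have hf₂ (x : ℝ) : deriv (deriv f) x = c * f x := by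
    refine mul_left_cancel₀ (pow_pos hε 2).ne' ?_
    linear_combination -heq x - f x * hc
  have hd₁ (x : ℝ) : HasDerivAt (fun x => -ε * deriv f x + (1 / 2) * t x * f x)
      (-ε * c * f x + (1 / 2) * ((1 - t x ^ 2) / (2 * ε) * f x + t x * deriv f x)) x := by
    refine (((hf' x).hasDerivAt.const_mul (-ε)).add
      (((ht x).const_mul (1 / 2)).mul (hf x).hasDerivAt)).congr_deriv ?_
    rw [hf₂]
    ring
  have hd₂ (x : ℝ) : HasDerivAt
      (fun x => -ε * c * f x + (1 / 2) * ((1 - t x ^ 2) / (2 * ε) * f x + t x * deriv f x))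
      (-ε * c * deriv f x + (1 / 2) * (-(2 * t x * ((1 - t x ^ 2) / (2 * ε))) / (2 * ε) * f x
        + 2 * ((1 - t x ^ 2) / (2 * ε)) * deriv f x + t x * (c * f x))) x := by
    refine (((hf x).hasDerivAt.const_mul (-ε * c)).add
      ((((((ht x).pow 2).const_sub 1).div_const (2 * ε)).mul (hf x).hasDerivAt).add
        ((ht x).mul (hf' x).hasDerivAt) |>.const_mul (1 / 2))).congr_deriv ?_
    simp only [hf₂, Pi.pow_apply]
    push_cast
    ring
  rw [funext fun x => (hd₁ x).deriv]
  refine ⟨⟨fun x => (hd₁ x).differentiableAt, fun x => (hd₂ x).differentiableAt⟩, fun x => ?_⟩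
  rw [(hd₂ x).deriv]
  have hlam : ε * lam = 1 / 4 - ε ^ 2 * c := by linear_combination hc
  rw [hlam]
  field_simp
  ring
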